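/- arXiv:1005.4258 — 7 statements merged into one kernel-verified Lean document; each statement's English description precedes it below -/
import Mathlib

section
/- For every positive integer m, multi-indices n, z ∈ ℕ^m, and complex numbers x, y, ε, one has ∑_{k=0}^{n} C(x − k·z, k) · C(y + k·z, n − k) = ∑_{k=0}^{n} C(x + ε − k·z, k) · C(y − ε + k·z, n − k) (Gould–Mohanty's identity). -/
/-- The multinomial coefficient `C(x, k) = x(x-1)⋯(x-|k|+1)/k!` for `x : ℂ`
and a multi-index `k : Fin m → ℕ`. -/
noncomputable def mchoose {m : ℕ} (x : ℂ) (k : Fin m → ℕ) : ℂ :=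
  (∏ j ∈ Finset.range (∑ i, k i), (x - (j : ℂ))) / ∏ i, (Nat.factorial (k i) : ℂ)

/-- The dot product `k·z = k₁z₁ + ⋯ + kₘzₘ` of multi-indices. -/
def mdot {m : ℕ} (k z : Fin m → ℕ) : ℕ := ∑ i, k i * z i

open Polynomial in
/-- The multinomial coefficient is polynomial in its upper argument. -/
lemma exists_polynomial_eval_eq_mchoose {m : ℕ} (a b : ℂ) (k : Fin m → ℕ) :
    ∃ P : ℂ[X], ∀ t, P.eval t = mchoose (a + b * t) k := by
  refine ⟨(∏ j ∈ Finset.range (∑ i, k i), (C a + C b * X - C (j : ℂ))) *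
    C (∏ i, (Nat.factorial (k i) : ℂ))⁻¹, fun t => ?_⟩
  rw [mchoose, div_eq_mul_inv, eval_mul, eval_C, eval_prod]
  simp only [eval_sub, eval_add, eval_mul, eval_C, eval_X]

lemma prod_range_add_one_sub (x : ℂ) (N : ℕ) :
    ∏ j ∈ Finset.range N, (x + 1 - (j : ℂ)) =
      ∏ j ∈ Finset.range N, (x - (j : ℂ)) +
        N * ∏ j ∈ Finset.range (N - 1), (x - (j : ℂ)) := by
  cases N with
  | zero => simp
  | succ N =>
    have h : ∏ j ∈ Finset.range (N + 1), (x + 1 - (j : ℂ)) =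
        (x + 1) * ∏ j ∈ Finset.range N, (x - (j : ℂ)) := by
      rw [Finset.prod_range_succ', mul_comm]
      congr 1
      · simp
      · exact Finset.prod_congr rfl fun j _ => by push_cast; ring
    rw [h, Finset.prod_range_succ, Nat.add_sub_cancel]
    push_cast
    ring

lemma sub_single_add_single {m : ℕ} {k : Fin m → ℕ} {i : Fin m} (hi : k i ≠ 0) :
    k - Pi.single i 1 + Pi.single i 1 = k := by
  funext j
  by_cases hj : j = i
  · subst hj
    simp only [Pi.add_apply, Pi.sub_apply, Pi.single_eq_same]
    omega
  · simp [hj]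

lemma sum_add_single {m : ℕ} (k : Fin m → ℕ) (i : Fin m) :
    ∑ j, (k + Pi.single i 1 : Fin m → ℕ) j = ∑ j, k j + 1 := by
  simp [Finset.sum_add_distrib]

lemma mdot_add_single {m : ℕ} (k z : Fin m → ℕ) (i : Fin m) :
    mdot (k + Pi.single i 1) z = mdot k z + z i := by
  simp [mdot, add_mul, Finset.sum_add_distrib, Pi.single_apply]

lemma prod_factorial_add_single {m : ℕ} (k : Fin m → ℕ) (i : Fin m) :
    ∏ j, (Nat.factorial ((k + Pi.single i 1 : Fin m → ℕ) j) : ℂ) =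
      (k i + 1) * ∏ j, (Nat.factorial (k j) : ℂ) := by
  rw [← Finset.mul_prod_erase _ _ (Finset.mem_univ i),
    ← Finset.mul_prod_erase _ (fun j => (Nat.factorial (k j) : ℂ)) (Finset.mem_univ i), ← mul_assoc]
  congr 1
  · simp [Nat.factorial_succ]
  · refine Finset.prod_congr rfl fun j hj => ?_
    simp [Finset.ne_of_mem_erase hj]

/-- Pascal's rule for multinomial coefficients. -/
lemma mchoose_add_one {m : ℕ} (x : ℂ) (k : Fin m → ℕ) :
    mchoose (x + 1) k =
      mchoose x k + ∑ i, if k i = 0 then 0 else mchoose x (k - Pi.single i 1) := by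
  have key : ∀ i, (if k i = 0 then 0 else mchoose x (k - Pi.single i 1)) =
      (k i : ℂ) * ((∏ j ∈ Finset.range (∑ i, k i - 1), (x - (j : ℂ))) /
        ∏ i, (Nat.factorial (k i) : ℂ)) := by
    intro i
    split_ifs with hi
    · simp [hi]
    · obtain ⟨l, rfl⟩ : ∃ l, k = l + (Pi.single i 1 : Fin m → ℕ) := ⟨_, (sub_single_add_single hi).symm⟩
      have h0 : ∏ j, (Nat.factorial (l j) : ℂ) ≠ 0 :=
        Finset.prod_ne_zero_iff.2 fun j _ => by exact_mod_cast Nat.factorial_ne_zero _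
      have h1 : (l i : ℂ) + 1 ≠ 0 := Nat.cast_add_one_ne_zero _
      rw [add_tsub_cancel_right, prod_factorial_add_single, sum_add_single, Nat.add_sub_cancel,
        mchoose]
      simp only [Pi.add_apply, Pi.single_eq_same, Nat.cast_add, Nat.cast_one]
      field_simp
  rw [Finset.sum_congr rfl fun i _ => key i, ← Finset.sum_mul, mchoose, mchoose,
    prod_range_add_one_sub]
  push_cast
  ring

lemma le_sub_single_iff {m : ℕ} {n k : Fin m → ℕ} {i : Fin m} (hn : n i ≠ 0) :
    k ≤ n - Pi.single i 1 ↔ k + Pi.single i 1 ≤ n := by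
  conv_rhs => rw [← sub_single_add_single hn]
  exact (add_le_add_iff_right _).symm

lemma sum_Iic_shift_left {m : ℕ} (n : Fin m → ℕ) (i : Fin m) (f : (Fin m → ℕ) → ℂ) :
    ∑ k ∈ Finset.Iic n, (if k i = 0 then 0 else f k) =
      if n i = 0 then 0 else ∑ k ∈ Finset.Iic (n - Pi.single i 1), f (k + Pi.single i 1) := by
  split_ifs with hn
  · refine Finset.sum_eq_zero fun k hk => if_pos ?_
    exact Nat.le_zero.1 (hn ▸ Finset.mem_Iic.1 hk i)
  · symm
    refine Finset.sum_of_injOn (· + Pi.single i 1) (fun _ _ _ _ h => add_right_cancel h) ?_ ?_ ?_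
    · intro k hk
      simpa using (le_sub_single_iff hn).1 (by simpa using hk)
    · intro k hk hk'
      refine if_pos (by_contra fun hi => hk' ⟨k - Pi.single i 1, ?_, sub_single_add_single hi⟩)
      rw [Finset.mem_coe, Finset.mem_Iic, le_sub_single_iff hn, sub_single_add_single hi]
      exact Finset.mem_Iic.1 hk
    · intro k _
      simp

lemma sum_Iic_shift_right {m : ℕ} (n : Fin m → ℕ) (i : Fin m) (f : (Fin m → ℕ) → ℂ) :
    ∑ k ∈ Finset.Iic n, (if (n - k) i = 0 then 0 else f k) =
      if n i = 0 then 0 else ∑ k ∈ Finset.Iic (n - Pi.single i 1), f k := by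
  split_ifs with hn
  · exact Finset.sum_eq_zero fun k _ => if_pos (by simp [hn])
  · rw [Finset.sum_ite, Finset.sum_const_zero, zero_add]
    refine Finset.sum_congr (Finset.ext fun k => ?_) fun _ _ => rfl
    rw [Finset.mem_filter, Finset.mem_Iic, Finset.mem_Iic, le_sub_single_iff hn]
    refine ⟨fun ⟨h, hi⟩ j => ?_, fun h => ⟨le_self_add.trans h, ?_⟩⟩
    · have := h j
      by_cases hj : j = i
      · subst hj
        simp only [Pi.sub_apply, Pi.add_apply, Pi.single_eq_same] at hi ⊢
        omega
      · simpa [hj] using this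
    · have := h i
      simp only [Pi.sub_apply, Pi.add_apply, Pi.single_eq_same] at this ⊢
      omega

/-- The sum in the Gould–Mohanty identity. -/
noncomputable def gouldSum {m : ℕ} (n z : Fin m → ℕ) (x y : ℂ) : ℂ :=
  ∑ k ∈ Finset.Iic n, mchoose (x - (mdot k z : ℂ)) k * mchoose (y + (mdot k z : ℂ)) (n - k)

lemma gouldSum_add_one_left {m : ℕ} (n z : Fin m → ℕ) (x y : ℂ) :
    gouldSum n z (x + 1) y = gouldSum n z x y +
      ∑ i, if n i = 0 then 0 else gouldSum (n - Pi.single i 1) z (x - z i) (y + z i) := by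
  have key : ∀ k : Fin m → ℕ,
      mchoose (x + 1 - (mdot k z : ℂ)) k * mchoose (y + (mdot k z : ℂ)) (n - k) =
      mchoose (x - (mdot k z : ℂ)) k * mchoose (y + (mdot k z : ℂ)) (n - k) +
      ∑ i, if k i = 0 then 0 else mchoose (x - (mdot k z : ℂ)) (k - Pi.single i 1) *
        mchoose (y + (mdot k z : ℂ)) (n - k) := by
    intro k
    rw [add_sub_right_comm, mchoose_add_one, add_mul, Finset.sum_mul]
    simp only [ite_mul, zero_mul]
  rw [gouldSum, Finset.sum_congr rfl fun k _ => key k, Finset.sum_add_distrib, Finset.sum_comm,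
    gouldSum]
  congr 1
  refine Finset.sum_congr rfl fun i _ => ?_
  rw [sum_Iic_shift_left]
  split_ifs with hn
  · rfl
  · refine Finset.sum_congr rfl fun k _ => ?_
    rw [mdot_add_single, add_tsub_cancel_right, add_comm k, ← tsub_tsub]
    push_cast
    congr 2 <;> ring

lemma gouldSum_add_one_right {m : ℕ} (n z : Fin m → ℕ) (x y : ℂ) :
    gouldSum n z x (y + 1) = gouldSum n z x y +
      ∑ i, if n i = 0 then 0 else gouldSum (n - Pi.single i 1) z x y := by
  have key : ∀ k : Fin m → ℕ,
      mchoose (x - (mdot k z : ℂ)) k * mchoose (y + 1 + (mdot k z : ℂ)) (n - k) =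
      mchoose (x - (mdot k z : ℂ)) k * mchoose (y + (mdot k z : ℂ)) (n - k) +
      ∑ i, if (n - k) i = 0 then 0 else mchoose (x - (mdot k z : ℂ)) k *
        mchoose (y + (mdot k z : ℂ)) (n - k - Pi.single i 1) := by
    intro k
    rw [add_right_comm, mchoose_add_one, mul_add, Finset.mul_sum]
    simp only [mul_ite, mul_zero]
  rw [gouldSum, Finset.sum_congr rfl fun k _ => key k, Finset.sum_add_distrib, Finset.sum_comm,
    gouldSum]
  congr 1
  refine Finset.sum_congr rfl fun i _ => ?_
  rw [sum_Iic_shift_right]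
  split_ifs with hn
  · rfl
  · exact Finset.sum_congr rfl fun k _ => by rw [tsub_right_comm]

open Polynomial in
lemma exists_polynomial_eval_eq_gouldSum {m : ℕ} (n z : Fin m → ℕ) (x y : ℂ) :
    ∃ P : ℂ[X], ∀ t, P.eval t = gouldSum n z (x + t) (y - t) := by
  choose P hP using fun k : Fin m → ℕ =>
    exists_polynomial_eval_eq_mchoose (x - (mdot k z : ℂ)) 1 k
  choose Q hQ using fun k : Fin m → ℕ =>
    exists_polynomial_eval_eq_mchoose (y + (mdot k z : ℂ)) (-1) (n - k)
  refine ⟨∑ k ∈ Finset.Iic n, P k * Q k, fun t => ?_⟩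
  rw [eval_finsetSum, gouldSum]
  refine Finset.sum_congr rfl fun k _ => ?_
  rw [eval_mul, hP, hQ]
  congr 2 <;> ring

lemma gouldSum_eq_of_shift {m : ℕ} {n z : Fin m → ℕ}
    (h : ∀ x y, gouldSum n z (x + 1) y = gouldSum n z x (y + 1)) (x y ε : ℂ) :
    gouldSum n z x y = gouldSum n z (x + ε) (y - ε) := by
  obtain ⟨P, hP⟩ := exists_polynomial_eval_eq_gouldSum n z x y
  have hnat : ∀ N : ℕ, P.eval (N : ℂ) = gouldSum n z x y := by
    intro N
    rw [hP]
    induction N with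
    | zero => simp
    | succ N ih =>
      rw [← ih, Nat.cast_succ, ← add_assoc, h]
      congr 1
      ring
  have hconst : P = Polynomial.C (gouldSum n z x y) := by
    refine Polynomial.eq_of_infinite_eval_eq _ _
      ((Set.infinite_range_of_injective (Nat.cast_injective (R := ℂ))).mono ?_)
    rintro _ ⟨N, rfl⟩
    simp [hnat]
  rw [← hP, hconst, Polynomial.eval_C]

theorem gouldSum_eq {m : ℕ} (n z : Fin m → ℕ) (x y ε : ℂ) :
    gouldSum n z x y = gouldSum n z (x + ε) (y - ε) := by
  induction hN : ∑ i, n i generalizing n x y ε with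
  | zero =>
    refine gouldSum_eq_of_shift (fun x y => ?_) x y ε
    have h0 : ∀ i, n i = 0 := by simpa using hN
    simp [gouldSum_add_one_left, gouldSum_add_one_right, h0]
  | succ N ih =>
    refine gouldSum_eq_of_shift (fun x y => ?_) x y ε
    rw [gouldSum_add_one_left, gouldSum_add_one_right]
    congr 1
    refine Finset.sum_congr rfl fun i _ => ?_
    split_ifs with hi
    · rfl
    · have hsum := sum_add_single (n - Pi.single i 1) i
      rw [sub_single_add_single hi, hN] at hsum
      rw [ih (n - Pi.single i 1) x y (-(z i : ℂ)) (by omega), sub_neg_eq_add, ← sub_eq_add_neg]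


/-- **Gould–Mohanty's identity.** -/
theorem gould_mohanty (m : ℕ) (hm : 0 < m) (n z : Fin m → ℕ) (x y ε : ℂ) :
    ∑ k ∈ Finset.Iic n,
        mchoose (x - (mdot k z : ℂ)) k * mchoose (y + (mdot k z : ℂ)) (n - k) =
      ∑ k ∈ Finset.Iic n,
        mchoose (x + ε - (mdot k z : ℂ)) k * mchoose (y - ε + (mdot k z : ℂ)) (n - k) := by
  exact gouldSum_eq n z x y ε
end

section
/- For every positive integer m, multi-indices n, z ∈ ℕ^m, and complex numbers x, y, one has ∑_{k=0}^{n} C(x + k·z, k) · C(y − k·z, n − k) = ∑_{k=0}^{n} C(x + y − |k|, n − k) · C(|k|, k) · z^k, where C(|k|, k) = |k|!/k! and z^k = z_1^{k_1}⋯z_m^{k_m} (Mohanty–Handa's identity). -/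
open Finset Polynomial fwdDiff_aux in
/-- A polynomial in the shift operator acts on functions through its coefficients, so a polynomial
written as a combination of monomials `X ^ e i` acts as a combination of shifts by `e i`. -/
lemma aeval_shift_sum_apply {M ι : Type*} [AddCommMonoid M] (h : M) (s : Finset ι)
    (c : ι → ℤ) (e : ι → ℕ) (f : M → ℂ) (y : M) :
    aeval (shiftₗ M ℂ h) (∑ i ∈ s, (c i : ℤ[X]) * X ^ e i) f y =
      ∑ i ∈ s, (c i : ℂ) * f (y + e i • h) := by
  simp only [map_sum, map_mul, map_intCast, map_pow, aeval_X, LinearMap.sum_apply,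
    Finset.sum_apply, Module.End.mul_apply, Module.End.intCast_apply, zsmul_eq_mul,
    Pi.mul_apply, Pi.intCast_apply, shiftₗ_pow_apply]

open Finset in
/-- The binomial theorem for a product of powers, with multi-index summation. -/
lemma prod_add_pow_eq_sum_Iic {ι R : Type*} [Fintype ι] [DecidableEq ι] [CommSemiring R]
    (a b : ι → R) (n : ι → ℕ) :
    ∏ i, (a i + b i) ^ n i =
      ∑ k ∈ Iic n, ∏ i, (a i ^ k i * b i ^ (n i - k i) * ((n i).choose (k i) : R)) := by
  have h : Iic n = Fintype.piFinset fun i => range (n i + 1) := by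
    ext k
    simp [Pi.le_def]
  simp_rw [add_pow, h, prod_univ_sum]

open Finset Polynomial fwdDiff_aux in
/-- Iterated Vandermonde convolution of binomial coefficients, tested against any `f`. -/
lemma sum_Iic_prod_choose_mul {ι : Type*} [Fintype ι] [DecidableEq ι] (n : ι → ℕ) (f : ℕ → ℂ) :
    ∑ k ∈ Iic n, (∏ i, ((n i).choose (k i) : ℂ)) * f (∑ i, k i) =
      ∑ d ∈ range (∑ i, n i + 1), ((∑ i, n i).choose d : ℂ) * f d := by
  have h : ∑ k ∈ Iic n, (((∏ i, (n i).choose (k i) : ℕ) : ℤ) : ℤ[X]) * X ^ (∑ i, k i) =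
      ∑ d ∈ range (∑ i, n i + 1), (((∑ i, n i).choose d : ℤ) : ℤ[X]) * X ^ d := by
    trans (X + 1 : ℤ[X]) ^ (∑ i, n i)
    · rw [← prod_pow_eq_pow_sum, prod_add_pow_eq_sum_Iic]
      refine sum_congr rfl fun k _ => ?_
      simp [prod_mul_distrib, prod_pow_eq_pow_sum, mul_comm]
    · rw [add_pow]
      simp [mul_comm]
  have := congrArg (fun q => aeval (shiftₗ ℕ ℂ 1) q f 0) h
  simp only [aeval_shift_sum_apply] at this
  simpa using this

open Finset Polynomial fwdDiff_aux in
/-- Mixed differences with steps `z i`, taken `n i` times, of a polynomial of degree `∑ i, n i`. -/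
lemma sum_Iic_neg_one_pow_mul_eval {ι : Type*} [Fintype ι] [DecidableEq ι] (n z : ι → ℕ)
    (P : ℂ[X]) (hP : P.natDegree = ∑ i, n i) (x : ℂ) :
    ∑ k ∈ Iic n, (-1 : ℂ) ^ (∑ i, (n i - k i)) * (∏ i, ((n i).choose (k i) : ℂ)) *
        P.eval (x + (∑ i, k i * z i : ℕ)) =
      (∏ i, (z i : ℂ) ^ n i) * (P.leadingCoeff * (∑ i, n i).factorial) := by
  have h : ∑ k ∈ Iic n,
        (((-1) ^ (∑ i, (n i - k i)) * ∏ i, ((n i).choose (k i) : ℤ) : ℤ) : ℤ[X]) *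
          X ^ (∑ i, k i * z i) =
      (∏ i, (∑ j ∈ range (z i), X ^ j) ^ n i) * (X - 1 : ℤ[X]) ^ (∑ i, n i) := by
    rw [← prod_pow_eq_pow_sum, ← prod_mul_distrib]
    simp_rw [← mul_pow, geom_sum_mul, sub_eq_add_neg]
    rw [prod_add_pow_eq_sum_Iic]
    refine sum_congr rfl fun k _ => ?_
    simp only [prod_mul_distrib, prod_pow_eq_pow_sum, ← pow_mul]
    push_cast
    simp only [mul_comm (z _)]
    ring
  have hΔ : aeval (shiftₗ ℂ ℂ 1) ((X - 1 : ℤ[X]) ^ (∑ i, n i)) P.eval =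
      fun _ => P.leadingCoeff * (∑ i, n i).factorial := by
    have : aeval (shiftₗ ℂ ℂ 1) (X - 1 : ℤ[X]) = fwdDiffₗ ℂ ℂ 1 := by simp [shiftₗ]
    rw [map_pow, this, coe_fwdDiffₗ_pow, ← hP, P.fwdDiff_iter_degree_eq_factorial]
    ext
    simp
  have hconst (q : ℤ[X]) (c : ℂ) : aeval (shiftₗ ℂ ℂ 1) q (fun _ => c) = fun _ => q.eval 1 * c := by
    induction q using Polynomial.induction_on' with
    | add p q hp hq =>
      ext
      simp [hp, hq, add_mul]
    | monomial d a =>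
      ext y
      have := aeval_shift_sum_apply (1 : ℂ) {()} (fun _ => a) (fun _ => d) (fun _ => c) y
      simpa [← C_mul_X_pow_eq_monomial] using this
  have := congrArg (fun q => aeval (shiftₗ ℂ ℂ 1) q P.eval x) h
  simp only [aeval_shift_sum_apply, map_mul, Module.End.mul_apply, hΔ] at this
  rw [hconst] at this
  simpa [eval_prod, eval_finsetSum] using this

open Finset in
/-- The falling factorial `x (x - 1) ⋯ (x - n + 1)`. -/
noncomputable def fallingFactorial (x : ℂ) (n : ℕ) : ℂ := ∏ j ∈ range n, (x - j)

lemma fallingFactorial_eq_eval (x : ℂ) (n : ℕ) :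
    fallingFactorial x n = (descPochhammer ℂ n).eval x :=
  (descPochhammer_eval_eq_prod_range n x).symm

lemma fallingFactorial_add_right (x : ℂ) (a b : ℕ) :
    fallingFactorial x (a + b) = fallingFactorial x a * fallingFactorial (x - a) b := by
  simp [fallingFactorial, Finset.prod_range_add, sub_sub]

lemma fallingFactorial_reflect (x : ℂ) (n : ℕ) :
    fallingFactorial x n = (-1) ^ n * fallingFactorial (n - 1 - x) n := by
  unfold fallingFactorial
  rw [← Finset.prod_range_reflect, Finset.pow_eq_prod_const, ← Finset.prod_mul_distrib]
  refine Finset.prod_congr rfl fun j hj => ?_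
  have := Finset.mem_range.mp hj
  rw [Nat.cast_sub (by omega), Nat.cast_sub (by omega)]
  push_cast
  ring

lemma fallingFactorial_natCast_self (n : ℕ) : fallingFactorial n n = n.factorial := by
  rw [fallingFactorial_eq_eval, descPochhammer_eval_eq_descFactorial, Nat.descFactorial_self]

open Finset in
/-- Chu–Vandermonde for falling factorials. -/
lemma fallingFactorial_add (a b : ℂ) (n : ℕ) :
    fallingFactorial (a + b) n = ∑ d ∈ range (n + 1),
      (n.choose d : ℂ) * (fallingFactorial a d * fallingFactorial b (n - d)) := by
  have h (x : ℂ) (d : ℕ) : (descPochhammer ℤ d).smeval x = fallingFactorial x d := by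
    rw [fallingFactorial_eq_eval, ← descPochhammer_map (algebraMap ℤ ℂ),
      Polynomial.eval_map_algebraMap, Polynomial.aeval_eq_smeval]
  have := Ring.descPochhammer_smeval_add n (Commute.all a b)
  simp only [h] at this
  rw [this, Nat.sum_antidiagonal_eq_sum_range_succ_mk]

open Finset in
lemma fallingFactorial_sub (a b : ℂ) (n : ℕ) :
    fallingFactorial (b - a) n = ∑ d ∈ range (n + 1), (n.choose d : ℂ) *
      ((-1) ^ d * fallingFactorial a d * fallingFactorial (b - d) (n - d)) := by
  rw [fallingFactorial_reflect, show (n : ℂ) - 1 - (b - a) = a + (n - 1 - b) by ring,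
    fallingFactorial_add, mul_sum]
  refine sum_congr rfl fun d hd => ?_
  have hd : d ≤ n := Nat.lt_succ_iff.mp (mem_range.mp hd)
  rw [fallingFactorial_reflect (b - d), Nat.cast_sub hd,
    show (n : ℂ) - d - 1 - (b - d) = n - 1 - b by ring]
  nth_rewrite 1 [← Nat.add_sub_of_le hd]
  rw [pow_add]
  ring

section mchoose

variable {m : ℕ}

lemma mchoose_eq (x : ℂ) (k : Fin m → ℕ) :
    mchoose x k = fallingFactorial x (∑ i, k i) / ∏ i, ((k i).factorial : ℂ) := rfl

lemma sum_sub_of_le {k n : Fin m → ℕ} (h : k ≤ n) :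
    ∑ i, (n - k) i = ∑ i, n i - ∑ i, k i :=
  Finset.sum_tsub_distrib _ fun i _ => h i

lemma mchoose_mul_mchoose_sub (a b : ℂ) {k n : Fin m → ℕ} (h : k ≤ n) :
    mchoose a k * mchoose b (n - k) = (∏ i, ((n i).choose (k i) : ℂ)) *
      (fallingFactorial a (∑ i, k i) * fallingFactorial b (∑ i, n i - ∑ i, k i)) /
        ∏ i, ((n i).factorial : ℂ) := by
  have h0 (l : Fin m → ℕ) : ∏ i, ((l i).factorial : ℂ) ≠ 0 :=
    Finset.prod_ne_zero_iff.mpr fun i _ => by exact_mod_cast (l i).factorial_ne_zero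
  have hn : ∏ i, ((n i).factorial : ℂ) = (∏ i, ((n i).choose (k i) : ℂ)) *
      (∏ i, ((k i).factorial : ℂ)) * ∏ i, (((n - k) i).factorial : ℂ) := by
    rw [← Finset.prod_mul_distrib, ← Finset.prod_mul_distrib]
    refine Finset.prod_congr rfl fun i _ => ?_
    exact_mod_cast (Nat.choose_mul_factorial_mul_factorial (h i)).symm
  have := h0 n
  rw [mchoose_eq, mchoose_eq, sum_sub_of_le h, div_mul_div_comm,
    div_eq_div_iff (mul_ne_zero (h0 k) (h0 _)) this, hn]
  ring

open Finset in
lemma mchoose_sub (a b : ℂ) (n : Fin m → ℕ) :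
    mchoose (b - a) n = ∑ k ∈ Iic n, (-1) ^ (∑ i, k i) * mchoose a k *
      mchoose (b - (∑ i, k i : ℕ)) (n - k) := by
  rw [mchoose_eq, fallingFactorial_sub, ← sum_Iic_prod_choose_mul n fun d => (-1) ^ d *
    fallingFactorial a d * fallingFactorial (b - d) (∑ i, n i - d), sum_div]
  refine sum_congr rfl fun k hk => ?_
  rw [mul_assoc _ (mchoose a k), mchoose_mul_mchoose_sub _ _ (mem_Iic.mp hk)]
  ring

open Finset in
lemma sum_Iic_neg_one_pow_mul_mchoose (n z : Fin m → ℕ) (x : ℂ) :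
    ∑ k ∈ Iic n, (-1) ^ (∑ i, (n - k) i) * (mchoose (x + (mdot k z : ℂ)) k *
        mchoose (x + (mdot k z : ℂ) - (∑ i, k i : ℕ)) (n - k)) =
      mchoose (∑ i, n i : ℕ) n * ∏ i, (z i : ℂ) ^ n i := by
  have h := sum_Iic_neg_one_pow_mul_eval n z (descPochhammer ℂ (∑ i, n i))
    (descPochhammer_natDegree ℂ _) x
  rw [(monic_descPochhammer ℂ _).leadingCoeff, one_mul] at h
  rw [mchoose_eq, fallingFactorial_natCast_self, div_mul_eq_mul_div, mul_comm _ (∏ i, _), ← h,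
    sum_div]
  refine sum_congr rfl fun k hk => ?_
  have hk := mem_Iic.mp hk
  rw [mchoose_mul_mchoose_sub _ _ hk, ← fallingFactorial_add_right,
    Nat.add_sub_of_le (sum_le_sum fun i _ => hk i), fallingFactorial_eq_eval, mdot]
  simp only [Pi.sub_apply]
  ring

end mchoose

open Finset in
lemma sum_Iic_sum_Iic_sub {ι R : Type*} [Fintype ι] [DecidableEq ι] [AddCommMonoid R]
    (n : ι → ℕ) (f : (ι → ℕ) → (ι → ℕ) → R) :
    ∑ k ∈ Iic n, ∑ j ∈ Iic (n - k), f k j = ∑ l ∈ Iic n, ∑ k ∈ Iic l, f k (l - k) := by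
  rw [sum_sigma', sum_sigma']
  refine sum_bij' (fun p _ => ⟨p.1 + p.2, p.1⟩) (fun p _ => ⟨p.2, p.1 - p.2⟩) ?_ ?_ ?_ ?_ ?_
  · rintro ⟨k, j⟩ h
    simp only [mem_sigma, mem_Iic] at h ⊢
    exact ⟨add_le_of_le_tsub_left_of_le h.1 h.2, le_self_add⟩
  · rintro ⟨l, k⟩ h
    simp only [mem_sigma, mem_Iic] at h ⊢
    exact ⟨h.2.trans h.1, tsub_le_tsub_right h.1 _⟩
  · rintro ⟨k, j⟩ h
    simp
  · rintro ⟨l, k⟩ h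
    simp only [mem_sigma, mem_Iic] at h
    simp [add_tsub_cancel_of_le h.2]
  · rintro ⟨k, j⟩ h
    simp

/-- **Mohanty–Handa's identity**:
`∑_{k=0}^{n} C(x + k·z, k) · C(y − k·z, n − k)
  = ∑_{k=0}^{n} C(x + y − |k|, n − k) · C(|k|, k) · z^k`. -/
theorem mohanty_handa (m : ℕ) (hm : 0 < m) (n z : Fin m → ℕ) (x y : ℂ) :
    ∑ k ∈ Finset.Iic n,
        mchoose (x + (mdot k z : ℂ)) k * mchoose (y - (mdot k z : ℂ)) (n - k) =
      ∑ k ∈ Finset.Iic n,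
        mchoose (x + y - (∑ i, k i : ℂ)) (n - k) * mchoose ((∑ i, k i : ℂ)) k *
          ∏ i, (z i : ℂ) ^ k i := by
  have expand (k : Fin m → ℕ) : mchoose (y - (mdot k z : ℂ)) (n - k) =
      ∑ j ∈ Finset.Iic (n - k), (-1) ^ (∑ i, j i) *
        mchoose (x + (mdot k z : ℂ) - (∑ i, k i : ℕ)) j *
          mchoose (x + y - (∑ i, (k + j) i : ℕ)) (n - (k + j)) := by
    rw [show y - (mdot k z : ℂ) =
      (x + y - (∑ i, k i : ℕ)) - (x + (mdot k z : ℂ) - (∑ i, k i : ℕ)) by ring, mchoose_sub]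
    refine Finset.sum_congr rfl fun j _ => ?_
    simp only [Pi.add_apply, Finset.sum_add_distrib, Nat.cast_add, sub_sub, tsub_tsub]
  simp_rw [expand, Finset.mul_sum]
  rw [sum_Iic_sum_Iic_sub]
  refine Finset.sum_congr rfl fun l _ => ?_
  rw [← Nat.cast_sum, mul_assoc, ← sum_Iic_neg_one_pow_mul_mchoose l z x, Finset.mul_sum]
  refine Finset.sum_congr rfl fun k hk => ?_
  rw [add_tsub_cancel_of_le (Finset.mem_Iic.mp hk)]
  ring
end

section
/- For every n ∈ ℕ, z ∈ ℕ, and complex numbers x, y such that x ≠ kz for every integer k with 0 ≤ k ≤ n, one has ∑_{k=0}^{n} (x/(x − kz)) · C(x − kz, k) · C(y + kz, n − k) = C(x + y, n) (Rothe's identity). -/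
/-- The generalized binomial coefficient `C(x, k) = x(x-1)⋯(x-k+1)/k!` for `x : ℂ`. -/
noncomputable def cchoose (x : ℂ) (k : ℕ) : ℂ :=
  (∏ j ∈ Finset.range k, (x - (j : ℂ))) / (Nat.factorial k : ℂ)

open Finset Polynomial

@[simp]
lemma cchoose_zero_right (x : ℂ) : cchoose x 0 = 1 := by
  simp [cchoose]

@[simp]
lemma cchoose_zero_succ (k : ℕ) : cchoose 0 (k + 1) = 0 := by
  simp [cchoose, prod_range_succ']

/-- Pascal's rule. -/
lemma cchoose_add_one_succ (x : ℂ) (k : ℕ) :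
    cchoose (x + 1) (k + 1) = cchoose x (k + 1) + cchoose x k := by
  have hk : (k.factorial : ℂ) ≠ 0 := by exact_mod_cast k.factorial_ne_zero
  have hk1 : (k + 1 : ℂ) ≠ 0 := by exact_mod_cast k.succ_ne_zero
  have hshift : ∏ j ∈ range k, (x + 1 - ((j + 1 : ℕ) : ℂ)) = ∏ j ∈ range k, (x - (j : ℂ)) :=
    prod_congr rfl fun j _ => by push_cast; ring
  unfold cchoose
  rw [prod_range_succ', hshift, prod_range_succ, Nat.factorial_succ]
  push_cast
  field_simp
  ring

lemma exists_polynomial_eval_eq_cchoose_add (c : ℂ) (k : ℕ) :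
    ∃ p : ℂ[X], ∀ y, p.eval y = cchoose (y + c) k :=
  ⟨C ((k.factorial : ℂ)⁻¹) * ∏ j ∈ range k, (X + C c - C (j : ℂ)), fun y => by
    simp [cchoose, eval_prod, div_eq_inv_mul]⟩

/-- A polynomial that is invariant under translation by `1` and has a root vanishes. -/
lemma Polynomial.eval_eq_zero_of_eval_add_one {p : ℂ[X]} {a : ℂ}
    (hshift : ∀ y, p.eval (y + 1) = p.eval y) (ha : p.eval a = 0) (y : ℂ) : p.eval y = 0 := by
  have hroot (m : ℕ) : p.IsRoot (a + m) := by
    induction m with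
    | zero => simpa using ha
    | succ m ih => rw [Nat.cast_succ, ← add_assoc, IsRoot, hshift]; exact ih
  have hinj : Function.Injective fun m : ℕ => a + (m : ℂ) := fun m m' h => by simpa using h
  rw [p.eq_zero_of_infinite_isRoot
    ((Set.infinite_range_of_injective hinj).mono (by rintro _ ⟨m, rfl⟩; exact hroot m)), eval_zero]

/-- A convolution of generalized binomial coefficients equals `C(x + y, n)` for all `y` as soon as
it does so for `y = -x`. -/
lemma sum_mul_cchoose_eq_cchoose_add (a c : ℕ → ℂ) (x : ℂ) (n : ℕ)
    (h : ∀ m ≤ n, ∑ k ∈ range (m + 1), a k * cchoose (-x + c k) (m - k) = cchoose 0 m) (y : ℂ) :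
    ∑ k ∈ range (n + 1), a k * cchoose (y + c k) (n - k) = cchoose (x + y) n := by
  induction n generalizing y with
  | zero => simpa using h 0 le_rfl
  | succ n ih =>
    have ih := ih fun m hm => h m (hm.trans n.le_succ)
    choose q hq using exists_polynomial_eval_eq_cchoose_add
    let p : ℂ[X] := ∑ k ∈ range (n + 2), C (a k) * q (c k) (n + 1 - k) - q x (n + 1)
    have hp (y : ℂ) : p.eval y =
        ∑ k ∈ range (n + 2), a k * cchoose (y + c k) (n + 1 - k) - cchoose (x + y) (n + 1) := by
      simp [p, eval_finsetSum, hq, add_comm x y]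
    rw [← sub_eq_zero, ← hp]
    refine eval_eq_zero_of_eval_add_one (a := -x) (fun y => ?_) ?_ y
    · have hsum : ∑ k ∈ range (n + 1), a k * cchoose (y + 1 + c k) (n + 1 - k) =
          ∑ k ∈ range (n + 1), a k * cchoose (y + c k) (n + 1 - k) +
            ∑ k ∈ range (n + 1), a k * cchoose (y + c k) (n - k) := by
        rw [← sum_add_distrib]
        refine sum_congr rfl fun k hk => ?_
        rw [Nat.sub_add_comm (mem_range_succ_iff.mp hk), add_right_comm y, cchoose_add_one_succ]
        ring
      rw [hp, hp, sum_range_succ, sum_range_succ _ (n + 1), hsum, ih y, ← add_assoc x,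
        cchoose_add_one_succ]
      simp only [Nat.sub_self, cchoose_zero_right]
      ring
    · rw [hp, h _ le_rfl, add_neg_cancel, sub_self]

lemma prod_range_sub_mul_prod_range_add (u : ℂ) (k m : ℕ) :
    (∏ j ∈ range k, (u - ((j + 1 : ℕ) : ℂ))) * ∏ j ∈ range m, (u + (j : ℂ)) =
      ∏ i ∈ range (k + m), (u - k + i) := by
  rw [prod_range_add, ← prod_range_reflect]
  congr 1
  · refine prod_congr rfl fun j hj => ?_
    rw [show k - 1 - j + 1 = k - j by have := mem_range.mp hj; omega,
      Nat.cast_sub (mem_range.mp hj).le]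
    ring
  · exact prod_congr rfl fun j _ => by push_cast; ring

lemma prod_range_sub_mul_prod_range_add_of_add_eq_succ (u : ℂ) {k m l : ℕ} (h : k + m = l + 1) :
    (∏ j ∈ range k, (u - (j : ℂ))) * ∏ j ∈ range m, (u + (j : ℂ)) =
      u * ∏ i ∈ range l, (u - k + 1 + i) := by
  cases k with
  | zero =>
    obtain rfl : m = l + 1 := by omega
    rw [prod_range_zero, one_mul, prod_range_succ', mul_comm, Nat.cast_zero, add_zero]
    congr 1
    exact prod_congr rfl fun j _ => by push_cast; ring
  | succ k =>
    obtain rfl : l = k + m := by omega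
    rw [prod_range_succ', mul_right_comm, prod_range_sub_mul_prod_range_add, mul_comm,
      Nat.cast_zero, sub_zero]
    congr 1
    exact prod_congr rfl fun j _ => by push_cast; ring

lemma cchoose_neg (u : ℂ) (m : ℕ) :
    cchoose (-u) m = (-1) ^ m * (∏ j ∈ range m, (u + (j : ℂ))) / (m.factorial : ℂ) := by
  unfold cchoose
  congr 1
  rw [← card_range m, ← prod_const, card_range, ← prod_mul_distrib]
  exact prod_congr rfl fun j _ => by ring

lemma inv_mul_cchoose_mul_cchoose_neg {u : ℂ} (hu : u ≠ 0) {k l : ℕ} (hk : k ≤ l + 1) :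
    u⁻¹ * cchoose u k * cchoose (-u) (l + 1 - k) =
      ((l + 1).factorial : ℂ)⁻¹ * ((-1) ^ (l + 1 - k) * ((l + 1).choose k : ℂ) *
        ∏ i ∈ range l, (u - k + 1 + i)) := by
  have hprod := prod_range_sub_mul_prod_range_add_of_add_eq_succ u (Nat.add_sub_cancel' hk)
  have hne (m : ℕ) : (m.factorial : ℂ) ≠ 0 := by exact_mod_cast m.factorial_ne_zero
  have h1 := hne k
  have h2 := hne (l + 1 - k)
  have h3 := hne (l + 1)
  rw [cchoose_neg, cchoose, Nat.cast_choose ℂ hk]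
  field_simp
  exact hprod

lemma sum_neg_one_pow_mul_choose_mul_eval {p : ℂ[X]} {n : ℕ} (hp : p.natDegree < n) :
    ∑ k ∈ range (n + 1), (-1) ^ (n - k) * (n.choose k : ℂ) * p.eval (k : ℂ) = 0 := by
  have h := congr_fun (fwdDiff_iter_eq_zero_of_degree_lt hp) 0
  rw [fwdDiff_iter_eq_sum_shift] at h
  simpa using h

/-- The case `y = -x` of Rothe's identity. -/
lemma sum_div_mul_cchoose_mul_cchoose_neg (n z : ℕ) (x : ℂ)
    (hx : ∀ k : ℕ, k ≤ n → x ≠ (k * z : ℕ)) :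
    ∑ k ∈ range (n + 1), x / (x - (k * z : ℕ)) * cchoose (x - (k * z : ℕ)) k *
      cchoose (-x + (k * z : ℕ)) (n - k) = cchoose 0 n := by
  cases n with
  | zero =>
    have h0 : x ≠ 0 := by simpa using hx 0 le_rfl
    simp [h0]
  | succ l =>
    let p : ℂ[X] := ∏ i ∈ range l, (C (-(z + 1 : ℂ)) * X + C (x + 1 + i))
    have hdeg : p.natDegree < l + 1 := by
      refine Nat.lt_succ_of_le ((natDegree_prod_le _ _).trans ?_)
      refine (sum_le_card_nsmul _ _ 1 fun i _ => ?_).trans (by simp)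
      exact natDegree_linear_le
    rw [cchoose_zero_succ, ← mul_zero (x * ((l + 1).factorial : ℂ)⁻¹),
      ← sum_neg_one_pow_mul_choose_mul_eval hdeg, mul_sum]
    refine sum_congr rfl fun k hk => ?_
    have hk := mem_range_succ_iff.mp hk
    have heval : p.eval (k : ℂ) = ∏ i ∈ range l, (x - (k * z : ℕ) - k + 1 + i) := by
      rw [eval_prod]
      refine prod_congr rfl fun i _ => ?_
      simp only [eval_add, eval_mul, eval_C, eval_X]
      push_cast
      ring
    have h := inv_mul_cchoose_mul_cchoose_neg (sub_ne_zero.mpr (hx k hk)) hk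
    rw [heval, mul_assoc x, ← h, neg_sub, ← neg_add_eq_sub, div_eq_mul_inv]
    ring

/-- **Rothe's identity.** -/
theorem rothe (n z : ℕ) (x y : ℂ) (hx : ∀ k : ℕ, k ≤ n → x ≠ (k * z : ℕ)) :
    ∑ k ∈ Finset.range (n + 1),
        x / (x - (k * z : ℕ)) * cchoose (x - (k * z : ℕ)) k *
          cchoose (y + (k * z : ℕ)) (n - k) =
      cchoose (x + y) n :=
  sum_mul_cchoose_eq_cchoose_add
    (fun k => x / (x - (k * z : ℕ)) * cchoose (x - (k * z : ℕ)) k) (fun k => (k * z : ℕ)) x n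
    (fun m hm => sum_div_mul_cchoose_mul_cchoose_neg m z x fun k hk => hx k (hk.trans hm)) y
end

section
/- For every n ∈ ℕ, z ∈ ℕ, and complex numbers x, y such that x ≠ kz and y ≠ (n − k)z for every integer k with 0 ≤ k ≤ n, and x + y ≠ nz, one has ∑_{k=0}^{n} (xy/((x − kz)(y − (n − k)z))) · C(x − kz, k) · C(y − (n − k)z, n − k) = ((x + y)/(x + y − nz)) · C(x + y − nz, n) (Rothe's second identity). -/
open Polynomial in
/-- The polynomial in `x` that agrees with `x / (x - k z) * C(x - k z, k)` away from `x = k z`. -/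
noncomputable def rothePoly (z : ℂ) : ℕ → ℂ[X]
  | 0 => 1
  | k + 1 => C (((k + 1).factorial : ℂ)⁻¹) *
      (X * ∏ j ∈ Finset.range k, (X - C ((k + 1) * z + j + 1)))

theorem eval_rothePoly_zero (z x : ℂ) : (rothePoly z 0).eval x = 1 := by
  simp [rothePoly]

theorem eval_rothePoly_succ (z x : ℂ) (k : ℕ) :
    (rothePoly z (k + 1)).eval x = ((k + 1).factorial : ℂ)⁻¹ *
      (x * ∏ j ∈ Finset.range k, (x - ((k + 1) * z + j + 1))) := by
  simp [rothePoly, Polynomial.eval_prod]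

theorem eval_rothePoly_eq_cchoose {z x : ℂ} {k : ℕ} (h : x ≠ k * z) :
    (rothePoly z k).eval x = x / (x - k * z) * cchoose (x - k * z) k := by
  have h' : x - k * z ≠ 0 := sub_ne_zero.mpr h
  cases k with
  | zero =>
    have hx : x ≠ 0 := by simpa using h
    simp [eval_rothePoly_zero, cchoose, hx]
  | succ k =>
    rw [eval_rothePoly_succ, cchoose, Finset.prod_range_succ']
    have hprod : ∏ j ∈ Finset.range k, (x - ((k + 1) * z + j + 1)) =
        ∏ j ∈ Finset.range k, (x - (k + 1 : ℕ) * z - (j + 1 : ℕ)) :=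
      Finset.prod_congr rfl fun j _ => by push_cast; ring
    rw [hprod, Nat.cast_zero, sub_zero]
    field_simp

/-- The forward difference of `rothePoly z (n + 1)` is `rothePoly z n` shifted by `z`. -/
theorem eval_rothePoly_succ_add_one (z x : ℂ) (n : ℕ) :
    (rothePoly z (n + 1)).eval (x + 1) =
      (rothePoly z (n + 1)).eval x + (rothePoly z n).eval (x - z) := by
  cases n with
  | zero => simp [eval_rothePoly_zero, eval_rothePoly_succ]
  | succ m =>
    simp only [eval_rothePoly_succ]
    rw [Finset.prod_range_succ', Finset.prod_range_succ]
    have hshift : ∏ j ∈ Finset.range m, (x + 1 - (((m + 1 : ℕ) + 1) * z + (j + 1 : ℕ) + 1)) =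
        ∏ j ∈ Finset.range m, (x - z - ((m + 1) * z + j + 1)) :=
      Finset.prod_congr rfl fun j _ => by push_cast; ring
    have hsame : ∏ j ∈ Finset.range m, (x - (((m + 1 : ℕ) + 1) * z + j + 1)) =
        ∏ j ∈ Finset.range m, (x - z - ((m + 1) * z + j + 1)) :=
      Finset.prod_congr rfl fun j _ => by push_cast; ring
    rw [hshift, hsame, Nat.factorial_succ (m + 1)]
    have hm : (m : ℂ) + 1 + 1 ≠ 0 := by exact_mod_cast Nat.succ_ne_zero (m + 1)
    have hf : ((m + 1).factorial : ℂ) ≠ 0 := by exact_mod_cast Nat.factorial_ne_zero _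
    push_cast
    field_simp
    ring

theorem Polynomial.eq_zero_of_eval_add_one {p : Polynomial ℂ} (h0 : p.eval 0 = 0)
    (h : ∀ x, p.eval (x + 1) = p.eval x) : p = 0 := by
  refine p.eq_zero_of_infinite_isRoot
    ((Set.infinite_range_of_injective (Nat.cast_injective (R := ℂ))).mono ?_)
  rintro _ ⟨m, rfl⟩
  induction m with
  | zero => simpa using h0
  | succ m ih => simpa [Polynomial.IsRoot, h] using ih

/-- The polynomials `rothePoly z n` form a convolution family. -/
theorem sum_eval_rothePoly_mul (z : ℂ) (n : ℕ) (x y : ℂ) :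
    ∑ k ∈ Finset.range (n + 1), (rothePoly z k).eval x * (rothePoly z (n - k)).eval y =
      (rothePoly z n).eval (x + y) := by
  induction n generalizing x y with
  | zero => simp [eval_rothePoly_zero]
  | succ n ih =>
    let p : Polynomial ℂ := ∑ k ∈ Finset.range (n + 2),
        rothePoly z k * Polynomial.C ((rothePoly z (n + 1 - k)).eval y) -
      (rothePoly z (n + 1)).comp (Polynomial.X + Polynomial.C y)
    have hp (t : ℂ) : p.eval t = ∑ k ∈ Finset.range (n + 2),
        (rothePoly z k).eval t * (rothePoly z (n + 1 - k)).eval y -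
          (rothePoly z (n + 1)).eval (t + y) := by
      simp [p, Polynomial.eval_finsetSum]
    have hp_zero : p = 0 := by
      refine Polynomial.eq_zero_of_eval_add_one ?_ fun t => ?_
      · rw [hp, Finset.sum_range_succ']
        simp [eval_rothePoly_zero, eval_rothePoly_succ]
      · have ht := ih (t - z) y
        rw [hp, hp, Finset.sum_range_succ', Finset.sum_range_succ' _ (n + 1),
          add_right_comm t 1 y, eval_rothePoly_succ_add_one, ← sub_add_eq_add_sub t z y, ← ht]
        simp only [eval_rothePoly_succ_add_one, eval_rothePoly_zero, add_mul,
          Finset.sum_add_distrib, Nat.add_sub_add_right]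
        ring
    exact sub_eq_zero.mp (by rw [← hp, hp_zero, Polynomial.eval_zero])

/-- **Rothe's second identity.** -/
theorem rothe_second (n z : ℕ) (x y : ℂ)
    (hx : ∀ k : ℕ, k ≤ n → x ≠ (k * z : ℕ))
    (hy : ∀ k : ℕ, k ≤ n → y ≠ ((n - k) * z : ℕ))
    (hxy : x + y ≠ (n * z : ℕ)) :
    ∑ k ∈ Finset.range (n + 1),
        x * y / ((x - (k * z : ℕ)) * (y - ((n - k) * z : ℕ))) *
          cchoose (x - (k * z : ℕ)) k * cchoose (y - ((n - k) * z : ℕ)) (n - k) =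
      (x + y) / (x + y - (n * z : ℕ)) * cchoose (x + y - (n * z : ℕ)) n := by
  push_cast at hxy ⊢
  rw [← eval_rothePoly_eq_cchoose hxy, ← sum_eval_rothePoly_mul]
  refine Finset.sum_congr rfl fun k hk => ?_
  have hkn : k ≤ n := Finset.mem_range_succ_iff.mp hk
  have hxk := hx k hkn
  have hyk := hy k hkn
  push_cast at hxk hyk
  rw [eval_rothePoly_eq_cchoose hxk, eval_rothePoly_eq_cchoose hyk, mul_div_mul_comm]
  ring
end

section
/- For every n ∈ ℕ, z ∈ ℕ, and complex numbers x, y, one has ∑_{k=0}^{n} C(x + kz, k) · C(y − kz, n − k) = ∑_{k=0}^{n} C(x + y − k, n − k) · z^k (Jensen's identity). -/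
open Finset Polynomial

theorem cchoose_eq_ringChoose (x : ℂ) (k : ℕ) : cchoose x k = Ring.choose x k := by
  rw [Ring.choose_eq_smul, ← aeval_eq_smeval, aeval_def, ← eval_map, descPochhammer_map,
    descPochhammer_eval_eq_prod_range, cchoose, smul_eq_mul, div_eq_inv_mul]

theorem cchoose_add (r s : ℂ) (n : ℕ) :
    cchoose (r + s) n = ∑ p ∈ antidiagonal n, cchoose r p.1 * cchoose s p.2 := by
  simp only [cchoose_eq_ringChoose, Ring.add_choose_eq n (Commute.all r s)]

/-- Upper negation. -/
theorem cchoose_eq_neg_one_pow_mul (x : ℂ) (k : ℕ) :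
    cchoose x k = (-1) ^ k * cchoose (k - 1 - x) k := by
  rw [cchoose_eq_ringChoose, cchoose_eq_ringChoose, ← neg_neg x, Ring.choose_neg]
  simp [Int.negOnePow_def, Units.smul_def]
  ring_nf

/-- Trinomial revision. -/
theorem cchoose_mul_cchoose_sub (x : ℂ) (k i : ℕ) :
    cchoose x k * cchoose (x - k) i = ((k + i).choose k : ℂ) * cchoose x (k + i) := by
  have h := Ring.choose_smul_choose x (Nat.le_add_right k i)
  simpa [cchoose_eq_ringChoose] using h.symm

/-- The `m`-th forward difference of a polynomial of degree at most `m`. -/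
theorem fwdDiff_iter_eval_of_natDegree_le {R : Type*} [CommRing R] {P : R[X]} {m : ℕ}
    (hP : P.natDegree ≤ m) (x : R) :
    (fwdDiff 1)^[m] P.eval x = P.coeff m * (m.factorial : R) := by
  rcases hP.lt_or_eq with h | rfl
  · simp [fwdDiff_iter_eq_zero_of_degree_lt h, coeff_eq_zero_of_natDegree_lt h]
  · rw [fwdDiff_iter_degree_eq_factorial]
    rfl

theorem sum_antidiagonal_neg_one_pow_mul_cchoose (x z : ℂ) (m : ℕ) :
    ∑ p ∈ antidiagonal m, (-1) ^ p.2 * (m.choose p.1 : ℂ) * cchoose (x + p.1 * z) m = z ^ m := by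
  set P : ℂ[X] := ∏ j ∈ range m, (C z * X + C (x - j)) with hPdef
  have hdeg (j : ℕ) : (C z * X + C (x - j)).natDegree ≤ 1 := natDegree_linear_le
  have hP : P.natDegree ≤ m :=
    (natDegree_prod_le _ _).trans <| (sum_le_sum fun j _ ↦ hdeg j).trans_eq <| by simp
  have hcoeff : P.coeff m = z ^ m := by
    have := coeff_prod_of_natDegree_le (s := range m) (fun j : ℕ ↦ C z * X + C (x - j)) 1
      fun j _ ↦ hdeg j
    simpa [-map_sub, ← hPdef] using this
  have h := fwdDiff_iter_eval_of_natDegree_le hP 0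
  rw [fwdDiff_iter_eq_sum_shift, hcoeff, ← Nat.sum_antidiagonal_eq_sum_range_succ
    (fun k l ↦ ((-1 : ℤ) ^ l * m.choose k) • P.eval (0 + k • 1))] at h
  have hne : (m.factorial : ℂ) ≠ 0 := Nat.cast_ne_zero.2 m.factorial_ne_zero
  rw [← mul_left_inj' hne, ← h, sum_mul]
  refine sum_congr rfl fun p _ ↦ ?_
  have heval : P.eval (0 + p.1 • 1) = ∏ j ∈ range m, (x + p.1 * z - j) := by
    simp only [hPdef, eval_prod]
    refine prod_congr rfl fun j _ ↦ ?_
    simp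
    ring
  rw [heval, cchoose, mul_assoc, div_mul_cancel₀ _ hne]
  simp

theorem cchoose_mul_cchoose_sub_eq_sum (u w : ℂ) (k l : ℕ) :
    cchoose u k * cchoose (w - u) l = ∑ p ∈ antidiagonal l,
      (-1) ^ p.1 * ((k + p.1).choose k : ℂ) * cchoose u (k + p.1) *
        cchoose (w - (k + p.1 : ℕ)) p.2 := by
  rw [cchoose_eq_neg_one_pow_mul (w - u), show (l : ℂ) - 1 - (w - u) = (u - k) + (k + l - 1 - w) by
    ring, cchoose_add, mul_sum, mul_sum]
  refine sum_congr rfl fun p hp ↦ ?_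
  obtain rfl := HasAntidiagonal.mem_antidiagonal.1 hp
  rw [cchoose_eq_neg_one_pow_mul (w - (k + p.1 : ℕ)), mul_assoc ((-1) ^ p.1),
    ← cchoose_mul_cchoose_sub]
  push_cast
  ring_nf

/-- Two ways to sum over all triples `(i, j, k)` with `i + j + k = n`. -/
theorem sum_antidiagonal_antidiagonal {M : Type*} [AddCommMonoid M] (f : ℕ → ℕ → ℕ → M) (n : ℕ) :
    ∑ p ∈ antidiagonal n, ∑ q ∈ antidiagonal p.1, f q.1 q.2 p.2 =
      ∑ p ∈ antidiagonal n, ∑ q ∈ antidiagonal p.2, f p.1 q.1 q.2 := by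
  rw [sum_sigma', sum_sigma']
  refine sum_bij' (fun a _ ↦ ⟨(a.2.1, a.2.2 + a.1.2), (a.2.2, a.1.2)⟩)
    (fun a _ ↦ ⟨(a.1.1 + a.2.1, a.2.2), (a.1.1, a.2.1)⟩) ?_ ?_ ?_ ?_ ?_ <;>
  rintro ⟨⟨a, b⟩, c, d⟩ h <;> simp only [mem_sigma, HasAntidiagonal.mem_antidiagonal] at h ⊢ <;>
  grind

/-- **Jensen's identity.** -/
theorem jensen (n z : ℕ) (x y : ℂ) :
    ∑ k ∈ Finset.range (n + 1),
        cchoose (x + (k * z : ℕ)) k * cchoose (y - (k * z : ℕ)) (n - k) =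
      ∑ k ∈ Finset.range (n + 1), cchoose (x + y - (k : ℕ)) (n - k) * (z : ℂ) ^ k := by
  rw [← Nat.sum_antidiagonal_eq_sum_range_succ
      (fun k l ↦ cchoose (x + (k * z : ℕ)) k * cchoose (y - (k * z : ℕ)) l),
    ← Nat.sum_antidiagonal_eq_sum_range_succ
      (fun k l ↦ cchoose (x + y - (k : ℕ)) l * (z : ℂ) ^ k)]
  have hsplit (k l : ℕ) :=
    cchoose_mul_cchoose_sub_eq_sum (x + (k * z : ℕ)) (x + y) k l
  simp only [add_sub_add_left_eq_sub] at hsplit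
  simp only [hsplit]
  rw [← sum_antidiagonal_antidiagonal (fun k i j ↦ (-1) ^ i * ((k + i).choose k : ℂ) *
    cchoose (x + (k * z : ℕ)) (k + i) * cchoose (x + y - (k + i : ℕ)) j) n]
  refine sum_congr rfl fun p _ ↦ ?_
  rw [← sum_antidiagonal_neg_one_pow_mul_cchoose x z p.1, mul_sum]
  refine sum_congr rfl fun q hq ↦ ?_
  rw [HasAntidiagonal.mem_antidiagonal.1 hq]
  push_cast
  ring
end

section
/- For every n ∈ ℕ and complex numbers x, y, z, one has ∑_{k=0}^{n} binom(n, k) · x · (x − kz)^{k−1} · (y + kz)^{n−k} = (x + y)^n, where for k ≥ 1 the factor x(x − kz)^{k−1} is interpreted as the polynomial x·(x − kz)^{k−1} and for k = 0 as x·(x)^{−1}·(y)^n = y^n, i.e., the k = 0 term equals y^n (Abel's identity); equivalently, the identity holds for all x, z ∈ ℂ with x − kz ≠ 0 whenever k = 0. -/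
/-- The `m`-th finite difference of a power `(x - k * z) ^ d` of degree `d < m` vanishes. -/
theorem sum_range_neg_one_pow_mul_choose_mul_sub_pow_eq_zero {R : Type*} [CommRing R] {d m : ℕ}
    (h : d < m) (x z : R) :
    ∑ k ∈ Finset.range (m + 1), (-1) ^ (m - k) * (m.choose k : R) * (x - k * z) ^ d = 0 := by
  open Polynomial in
  have hdeg : ((C x - C z * X) ^ d : R[X]).natDegree < m :=
    (natDegree_pow_le_of_le d (by compute_degree : (C x - C z * X : R[X]).natDegree ≤ 1)).trans_lt
      (by simpa using h)
  have key := congrFun (Polynomial.fwdDiff_iter_eq_zero_of_degree_lt hdeg) 0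
  rw [fwdDiff_iter_eq_sum_shift] at key
  simpa [mul_comm z] using key

/-- `(x - k z) ^ (k - 1) * (x - k z) ^ (m - k) = (x - k z) ^ (m - 1)`; the base may vanish, but
not at `k = 0`, the only index where a negative exponent occurs. -/
theorem zpow_sub_one_mul_pow_sub {x : ℂ} (hx : x ≠ 0) (z : ℂ) {k m : ℕ} (hm : 0 < m)
    (hk : k ≤ m) :
    (x - (k : ℂ) * z) ^ ((k : ℤ) - 1) * (x - (k : ℂ) * z) ^ (m - k) =
      (x - (k : ℂ) * z) ^ (m - 1) := by
  rcases k with _ | k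
  · obtain ⟨m, rfl⟩ := Nat.exists_eq_add_one.mpr hm
    simp [pow_succ, hx, mul_comm]
  · simp only [Nat.cast_add, Nat.cast_one, add_sub_cancel_right, zpow_natCast, ← pow_add]
    congr 1
    omega

/-- **Abel's identity**: for `x ≠ 0` (so that the `k = 0` term
`x · x⁻¹ · yⁿ = yⁿ` is well defined, using integer powers),
`∑_{k=0}^{n} binom(n, k) · x · (x − kz)^{k−1} · (y + kz)^{n−k} = (x + y)^n`. -/
theorem abel (n : ℕ) (x y z : ℂ) (hx : x ≠ 0) :
    ∑ k ∈ Finset.range (n + 1),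
        (Nat.choose n k : ℂ) * x * (x - (k : ℂ) * z) ^ ((k : ℤ) - 1) *
          (y + (k : ℂ) * z) ^ (n - k) =
      (x + y) ^ n := by
  have expand {k : ℕ} (hk : k ≤ n) : (y + (k : ℂ) * z) ^ (n - k) =
      ∑ m ∈ Finset.Ico k (n + 1), (x + y) ^ (n - m) *
        ((-1) ^ (m - k) * (x - k * z) ^ (m - k)) * ((n - k).choose (m - k) : ℂ) := by
    rw [show y + (k : ℂ) * z = -(x - k * z) + (x + y) by ring, add_pow,
      Finset.sum_Ico_eq_sum_range, Nat.sub_add_comm hk]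
    refine Finset.sum_congr rfl fun i _ ↦ ?_
    rw [neg_pow, Nat.add_sub_cancel_left, Nat.sub_sub]
    ring
  calc
    _ = ∑ k ∈ Finset.range (n + 1), ∑ m ∈ Finset.Ico k (n + 1),
          (n.choose m : ℂ) * (x + y) ^ (n - m) * x * ((-1) ^ (m - k) * (m.choose k : ℂ) *
            ((x - k * z) ^ ((k : ℤ) - 1) * (x - k * z) ^ (m - k))) := by
      refine Finset.sum_congr rfl fun k hk ↦ ?_
      rw [expand (Finset.mem_range_succ_iff.mp hk), Finset.mul_sum]
      refine Finset.sum_congr rfl fun m hm ↦ ?_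
      have hchoose : (n.choose m : ℂ) * m.choose k = n.choose k * (n - k).choose (m - k) :=
        mod_cast Nat.choose_mul (Finset.mem_Ico.mp hm).1
      linear_combination (-(x + y) ^ (n - m) * x * (-1) ^ (m - k) *
        (x - k * z) ^ ((k : ℤ) - 1) * (x - k * z) ^ (m - k)) * hchoose
    _ = ∑ m ∈ Finset.range (n + 1), ∑ k ∈ Finset.range (m + 1),
          (n.choose m : ℂ) * (x + y) ^ (n - m) * x * ((-1) ^ (m - k) * (m.choose k : ℂ) *
            ((x - k * z) ^ ((k : ℤ) - 1) * (x - k * z) ^ (m - k))) :=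
      Finset.sum_comm' fun k m ↦ by simp only [Finset.mem_range, Finset.mem_Ico]; omega
    _ = (x + y) ^ n := by
      rw [Finset.sum_eq_single_of_mem 0 (by simp)]
      · simp [hx]
      · intro m _ hm
        have hpos := Nat.pos_of_ne_zero hm
        rw [← Finset.mul_sum, ← mul_zero ((n.choose m : ℂ) * (x + y) ^ (n - m) * x),
          ← sum_range_neg_one_pow_mul_choose_mul_sub_pow_eq_zero
            (Nat.sub_lt hpos Nat.one_pos) x z]
        congr 1
        refine Finset.sum_congr rfl fun k hk ↦ ?_
        rw [zpow_sub_one_mul_pow_sub hx z hpos (Finset.mem_range_succ_iff.mp hk)]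
end

section
/- Let u and v be words over Γ such that ||u|| ≥ n·z + 1 and ||v|| ≥ n·z + 1, where n = (n_1,…,n_m) with n_i = |u·v|_{b_i} the number of occurrences of b_i in the concatenation u·v. Then there exist a nonempty prefix x of u and a nonempty prefix y of v with ||x|| = ||y||. -/
/-- The alphabet `Γ = {a, b₁, …, bₘ}`: `none` encodes the letter `a`, and
`some i` encodes the letter `bᵢ`. -/
abbrev Letter (m : ℕ) := Option (Fin m)

/-- The grading of letters: `‖a‖ = 1` and `‖bᵢ‖ = zᵢ + 1`. -/
def letterWt {m : ℕ} (z : Fin m → ℕ) : Letter m → ℕ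
  | none => 1
  | some i => z i + 1

/-- The weight `‖w‖` of a word: the sum of the weights of its letters. -/
def wordWt {m : ℕ} (z : Fin m → ℕ) (w : List (Letter m)) : ℕ :=
  (w.map (letterWt z)).sum

theorem wordWt_append {m : ℕ} (z : Fin m → ℕ) (x y : List (Letter m)) :
    wordWt z (x ++ y) = wordWt z x + wordWt z y := by
  simp [wordWt]

/-- The weight of a word is its length plus the total excess of its letters. -/
theorem wordWt_eq_length_add {m : ℕ} (z : Fin m → ℕ) (w : List (Letter m)) :
    wordWt z w = w.length + ∑ i, w.count (some i) * z i := by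
  induction w with
  | nil => simp [wordWt]
  | cons c w ih =>
    have h : wordWt z (c :: w) = letterWt z c + wordWt z w := by simp [wordWt]
    rw [h, ih]
    cases c with
    | none => simp [letterWt]; omega
    | some j =>
      simp [letterWt, List.count_cons, add_mul, Finset.sum_add_distrib]
      omega

theorem wordWt_take_lt {m : ℕ} (z : Fin m → ℕ) (w : List (Letter m)) {i j : ℕ}
    (hij : i < j) (hj : j ≤ w.length) : wordWt z (w.take i) < wordWt z (w.take j) := by
  have h := wordWt_append z ((w.take j).take i) ((w.take j).drop i)
  rw [List.take_append_drop, List.take_take, min_eq_left hij.le] at h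
  have h' := wordWt_eq_length_add z ((w.take j).drop i)
  simp only [List.length_drop, List.length_take, min_eq_left hj] at h'
  omega

/-- The weights of the nonempty prefixes of a word. -/
def prefixWts {m : ℕ} (z : Fin m → ℕ) (w : List (Letter m)) : Finset ℕ :=
  (Finset.range w.length).image fun k => wordWt z (w.take (k + 1))

theorem card_prefixWts {m : ℕ} (z : Fin m → ℕ) (w : List (Letter m)) :
    (prefixWts z w).card = w.length := by
  rw [prefixWts, Finset.card_image_of_injOn, Finset.card_range]
  intro i hi j hj hij
  simp only [Finset.coe_range, Set.mem_Iio] at hi hj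
  dsimp only at hij
  rcases lt_trichotomy i j with h | h | h
  · exact absurd hij (wordWt_take_lt z w (Nat.succ_lt_succ h) hj).ne
  · exact h
  · exact absurd hij (wordWt_take_lt z w (Nat.succ_lt_succ h) hi).ne'

theorem prefixWts_subset_Icc {m : ℕ} (z : Fin m → ℕ) (w : List (Letter m)) :
    prefixWts z w ⊆ Finset.Icc 1 (wordWt z w) := by
  intro s hs
  simp only [prefixWts, Finset.mem_image, Finset.mem_range] at hs
  obtain ⟨k, hk, rfl⟩ := hs
  have h := wordWt_append z (w.take (k + 1)) (w.drop (k + 1))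
  rw [List.take_append_drop] at h
  have h' : wordWt z (w.take 0) < wordWt z (w.take (k + 1)) := wordWt_take_lt z w k.succ_pos hk
  rw [Finset.mem_Icc]
  omega

/-- The number of values up to `‖w‖` that no prefix weight attains is the excess of `w`. -/
theorem card_Icc_sdiff_prefixWts {m : ℕ} (z : Fin m → ℕ) (w : List (Letter m)) :
    (Finset.Icc 1 (wordWt z w) \ prefixWts z w).card = ∑ i, w.count (some i) * z i := by
  rw [Finset.card_sdiff_of_subset (prefixWts_subset_Icc z w), card_prefixWts, Nat.card_Icc,
    wordWt_eq_length_add]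
  omega

theorem exists_prefix_of_mem_prefixWts {m : ℕ} {z : Fin m → ℕ} {w : List (Letter m)} {s : ℕ}
    (hs : s ∈ prefixWts z w) : ∃ x, x ≠ [] ∧ x <+: w ∧ wordWt z x = s := by
  simp only [prefixWts, Finset.mem_image, Finset.mem_range] at hs
  obtain ⟨k, hk, rfl⟩ := hs
  refine ⟨w.take (k + 1), ?_, List.take_prefix _ _, rfl⟩
  rw [← List.length_pos_iff, List.length_take]
  omega

/-- **Lemma 2.1**: if `u` and `v` are words over `Γ` with `‖u‖ ≥ n·z + 1` and
`‖v‖ ≥ n·z + 1`, where `nᵢ = |u⋅v|_{bᵢ}`, then there exist nonempty prefixes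
`x` of `u` and `y` of `v` with `‖x‖ = ‖y‖`. -/
theorem exists_prefixes_of_equal_weight (m : ℕ) (hm : 0 < m) (z : Fin m → ℕ)
    (u v : List (Letter m))
    (hu : ∑ i, ((u ++ v).count (some i)) * z i + 1 ≤ wordWt z u)
    (hv : ∑ i, ((u ++ v).count (some i)) * z i + 1 ≤ wordWt z v) :
    ∃ x y : List (Letter m), x ≠ [] ∧ y ≠ [] ∧ x <+: u ∧ y <+: v ∧
      wordWt z x = wordWt z y := by
  obtain ⟨s, hsu, hsv⟩ : ∃ s, s ∈ prefixWts z u ∧ s ∈ prefixWts z v := by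
    by_contra! h
    have hsub : Finset.Icc 1 (∑ i, ((u ++ v).count (some i)) * z i + 1) ⊆
        (Finset.Icc 1 (wordWt z u) \ prefixWts z u) ∪
          (Finset.Icc 1 (wordWt z v) \ prefixWts z v) := by
      intro s hs
      simp only [Finset.mem_Icc, Finset.mem_union, Finset.mem_sdiff] at hs ⊢
      by_cases hsu : s ∈ prefixWts z u
      · exact Or.inr ⟨⟨hs.1, hs.2.trans hv⟩, h s hsu⟩
      · exact Or.inl ⟨⟨hs.1, hs.2.trans hu⟩, hsu⟩
    have hcard := (Finset.card_le_card hsub).trans (Finset.card_union_le _ _)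
    simp only [card_Icc_sdiff_prefixWts, Nat.card_Icc, List.count_append, add_mul,
      Finset.sum_add_distrib] at hcard
    omega
  obtain ⟨x, hx, hxu, hxs⟩ := exists_prefix_of_mem_prefixWts hsu
  obtain ⟨y, hy, hyv, hys⟩ := exists_prefix_of_mem_prefixWts hsv
  exact ⟨x, y, hx, hy, hxu, hyv, hxs.trans hys.symm⟩
end
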